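/- arXiv:1904.06984 — 4 statements merged into one kernel-verified Lean document; each statement's English description precedes it below -/
import Mathlib

section
/- For every integer d ≥ 2 and every real z: Σ_{n=0}^∞ (d−2)!! / ((2n)!!·(d+2n−2)!!) · z^{2n} = exp(−z) · Σ_{k=0}^∞ ( ∏_{j=0}^{k−1} ((d−1)/2 + j)/(d−1+j) ) · (2^k / k!) · z^k, with both series converging absolutely. -/
open Real Nat

open PowerSeries in
/-- If `W` solves the differential equation `hW`, then the coefficients of `exp * W` satisfy the
recurrence of the confluent hypergeometric series `₁F₁(c/2; c; 2X)`. -/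
lemma coeff_exp_mul_recurrence (c : ℝ) (W : PowerSeries ℝ)
    (hW : X * d⁄dX ℝ (d⁄dX ℝ W) + C c * d⁄dX ℝ W = X * W) (k : ℕ) :
    ((k : ℝ) + 1) * (k + c) * coeff (k + 1) (exp ℝ * W) =
      (2 * k + c) * coeff k (exp ℝ * W) := by
  have hE : d⁄dX ℝ (exp ℝ) = exp ℝ := by
    ext n
    rw [coeff_derivative, coeff_exp, coeff_exp, Nat.factorial_succ]
    push_cast
    field_simp
  obtain ⟨M, hM⟩ : ∃ M, M = exp ℝ * W := ⟨_, rfl⟩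
  have h1 : d⁄dX ℝ M = exp ℝ * (W + d⁄dX ℝ W) := by
    rw [hM, Derivation.leibniz, hE, smul_eq_mul, smul_eq_mul]; ring
  have h2 : d⁄dX ℝ (d⁄dX ℝ M) =
      exp ℝ * (W + 2 * d⁄dX ℝ W + d⁄dX ℝ (d⁄dX ℝ W)) := by
    rw [h1, Derivation.leibniz, hE, smul_eq_mul, smul_eq_mul, map_add]; ring
  have key : X * d⁄dX ℝ (d⁄dX ℝ M) + C c * d⁄dX ℝ M = C 2 * (X * d⁄dX ℝ M) + C c * M := by
    rw [h2, h1, hM, show (C (2 : ℝ) : PowerSeries ℝ) = 2 from map_ofNat C 2]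
    linear_combination exp ℝ * hW
  rw [← hM]
  have hk := congrArg (coeff k) key
  cases k with
  | zero =>
    simp only [map_add, coeff_C_mul, coeff_derivative, coeff_zero_X_mul] at hk
    push_cast at hk ⊢
    linear_combination hk
  | succ m =>
    simp only [map_add, coeff_C_mul, coeff_derivative, coeff_succ_X_mul] at hk
    push_cast at hk ⊢
    linear_combination hk

/-- The sequence `a` spread over the even indices and extended by zero. -/
noncomputable def evenExtension (a : ℕ → ℝ) (m : ℕ) : ℝ := if Even m then a (m / 2) else 0

lemma evenExtension_two_mul (a : ℕ → ℝ) (n : ℕ) : evenExtension a (2 * n) = a n := by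
  simp [evenExtension]

lemma evenExtension_of_odd (a : ℕ → ℝ) {m : ℕ} (hm : ¬ Even m) : evenExtension a m = 0 := by
  simp [evenExtension, hm]

open PowerSeries in
/-- A sequence with the recurrence of the Bessel-type series `₀F₁(; (c + 1)/2; X²/4)` solves
the corresponding differential equation. -/
lemma evenExtension_differential_equation (c : ℝ) (a : ℕ → ℝ)
    (ha : ∀ n : ℕ, (2 * (n : ℝ) + 2) * (2 * n + 1 + c) * a (n + 1) = a n) :
    X * d⁄dX ℝ (d⁄dX ℝ (mk (evenExtension a))) + C c * d⁄dX ℝ (mk (evenExtension a)) =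
      X * mk (evenExtension a) := by
  ext m
  cases m with
  | zero =>
    simp only [map_add, coeff_C_mul, coeff_derivative, coeff_zero_X_mul, coeff_mk]
    simp [evenExtension]
  | succ m =>
    simp only [map_add, coeff_C_mul, coeff_derivative, coeff_succ_X_mul, coeff_mk]
    rcases Nat.even_or_odd' m with ⟨n, rfl | rfl⟩
    · rw [show 2 * n + 1 + 1 = 2 * (n + 1) by ring, evenExtension_two_mul,
        evenExtension_two_mul, ← ha n]
      push_cast
      ring
    · rw [evenExtension_of_odd a (m := 2 * n + 1 + 1 + 1) (by grind),
        evenExtension_of_odd a (m := 2 * n + 1) (by grind)]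
      simp

lemma doubleFactorial_coeff_recurrence (d : ℕ) (hd : 2 ≤ d) (n : ℕ) :
    (2 * (n : ℝ) + 2) * (2 * n + 1 + ((d : ℝ) - 1)) *
        (((d - 2)‼ : ℝ) / (((2 * (n + 1))‼ : ℝ) * ((d + 2 * (n + 1) - 2)‼ : ℝ))) =
      ((d - 2)‼ : ℝ) / (((2 * n)‼ : ℝ) * ((d + 2 * n - 2)‼ : ℝ)) := by
  obtain ⟨e, rfl⟩ := Nat.exists_eq_add_of_le' hd
  rw [show e + 2 + 2 * (n + 1) - 2 = e + 2 * n + 2 by omega,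
    show e + 2 + 2 * n - 2 = e + 2 * n by omega, show 2 * (n + 1) = 2 * n + 2 by ring,
    Nat.doubleFactorial_add_two, Nat.doubleFactorial_add_two]
  have h1 : ((2 * n)‼ : ℝ) ≠ 0 := by exact_mod_cast (Nat.doubleFactorial_pos _).ne'
  have h2 : ((e + 2 * n)‼ : ℝ) ≠ 0 := by exact_mod_cast (Nat.doubleFactorial_pos _).ne'
  have h3 : (e : ℝ) + 2 * n + 2 ≠ 0 := by positivity
  push_cast
  field_simp
  ring

lemma doubleFactorial_le_add_two_mul (e n : ℕ) : e‼ ≤ (e + 2 * n)‼ := by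
  induction n with
  | zero => simp
  | succ n ih =>
    rw [show e + 2 * (n + 1) = e + 2 * n + 2 by ring, Nat.doubleFactorial_add_two]
    exact ih.trans (Nat.le_mul_of_pos_left _ (by omega))

lemma summable_doubleFactorial_coeff (d : ℕ) (hd : 2 ≤ d) (z : ℝ) :
    Summable (fun n : ℕ =>
      |((d - 2)‼ : ℝ) / (((2 * n)‼ : ℝ) * ((d + 2 * n - 2)‼ : ℝ)) * z ^ (2 * n)|) := by
  refine Summable.of_nonneg_of_le (fun _ => abs_nonneg _) (fun n => ?_)
    (Real.summable_pow_div_factorial (z ^ 2))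
  have h0 : (0 : ℝ) ≤ z ^ (2 * n) := by rw [pow_mul]; positivity
  rw [abs_of_nonneg (by positivity), pow_mul, div_eq_mul_inv _ (n ! : ℝ), mul_comm]
  refine mul_le_mul_of_nonneg_left ?_ (by positivity)
  have h1 : (n ! : ℝ) ≤ ((2 * n)‼ : ℝ) := by
    rw [Nat.doubleFactorial_two_mul]
    exact_mod_cast Nat.le_mul_of_pos_left _ (by positivity)
  have h2 : ((d - 2)‼ : ℝ) ≤ ((d + 2 * n - 2)‼ : ℝ) := by
    rw [show d + 2 * n - 2 = d - 2 + 2 * n by omega]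
    exact_mod_cast doubleFactorial_le_add_two_mul _ _
  have hn : (0 : ℝ) < (n ! : ℝ) := by exact_mod_cast Nat.factorial_pos n
  have hp : (0 : ℝ) < ((d + 2 * n - 2)‼ : ℝ) := by exact_mod_cast Nat.doubleFactorial_pos _
  have hq : (0 : ℝ) < ((2 * n)‼ : ℝ) := by exact_mod_cast Nat.doubleFactorial_pos _
  rw [inv_eq_one_div, div_le_div_iff₀ (by positivity) hn, one_mul, mul_comm]
  exact mul_le_mul h1 h2 (by positivity) hq.le

open PowerSeries in
lemma coeff_exp_mul_evenExtension (c : ℝ) (hc : 0 < c) (a : ℕ → ℝ) (ha0 : a 0 = 1)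
    (ha : ∀ n : ℕ, (2 * (n : ℝ) + 2) * (2 * n + 1 + c) * a (n + 1) = a n) (k : ℕ) :
    coeff k (exp ℝ * mk (evenExtension a)) =
      (∏ j ∈ Finset.range k, (c / 2 + j) / (c + j)) * (2 ^ k / (k ! : ℝ)) := by
  induction k with
  | zero => simp [evenExtension, ha0]
  | succ k ih =>
    have h := coeff_exp_mul_recurrence c _ (evenExtension_differential_equation c a ha) k
    rw [ih] at h
    have h1 : (k : ℝ) + c ≠ 0 := by positivity
    have h2 : c + (k : ℝ) ≠ 0 := by positivity
    have h3 : (k : ℝ) + 1 ≠ 0 := by positivity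
    refine mul_left_cancel₀ (mul_ne_zero h3 h1) (h.trans ?_)
    rw [Finset.prod_range_succ, Nat.factorial_succ]
    push_cast
    field_simp
    ring

theorem Fd_closed_form (d : ℕ) (hd : 2 ≤ d) (z : ℝ) :
    Summable (fun n : ℕ =>
      |((d - 2)‼ : ℝ) / (((2 * n)‼ : ℝ) * ((d + 2 * n - 2)‼ : ℝ)) * z ^ (2 * n)|) ∧
    Summable (fun k : ℕ =>
      |(∏ j ∈ Finset.range k, (((d : ℝ) - 1) / 2 + j) / ((d : ℝ) - 1 + j)) *
        (2 ^ k / (k ! : ℝ)) * z ^ k|) ∧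
    (∑' n : ℕ, ((d - 2)‼ : ℝ) / (((2 * n)‼ : ℝ) * ((d + 2 * n - 2)‼ : ℝ)) * z ^ (2 * n)) =
      Real.exp (-z) *
        ∑' k : ℕ, (∏ j ∈ Finset.range k, (((d : ℝ) - 1) / 2 + j) / ((d : ℝ) - 1 + j)) *
          (2 ^ k / (k ! : ℝ)) * z ^ k := by
  have hsum := summable_doubleFactorial_coeff d hd z
  obtain ⟨a, ha⟩ : ∃ a : ℕ → ℝ, a = fun n : ℕ =>
    ((d - 2)‼ : ℝ) / (((2 * n)‼ : ℝ) * ((d + 2 * n - 2)‼ : ℝ)) := ⟨_, rfl⟩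
  have hc : (0 : ℝ) < (d : ℝ) - 1 := by
    have : (2 : ℝ) ≤ d := by exact_mod_cast hd
    linarith
  have ha0 : a 0 = 1 := by
    have : ((d - 2)‼ : ℝ) ≠ 0 := by exact_mod_cast (Nat.doubleFactorial_pos _).ne'
    simp [ha, this]
  have harec : ∀ n : ℕ,
      (2 * (n : ℝ) + 2) * (2 * n + 1 + ((d : ℝ) - 1)) * a (n + 1) = a n := by
    intro n
    rw [ha]
    exact doubleFactorial_coeff_recurrence d hd n
  have hinj : Function.Injective (fun n : ℕ => 2 * n) := fun m n h => by
    simpa using h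
  have hzero : ∀ m ∉ Set.range (fun n : ℕ => 2 * n), evenExtension a m * z ^ m = 0 := by
    intro m hm
    rw [evenExtension_of_odd a fun ⟨r, hr⟩ => hm ⟨r, by simp only; omega⟩, zero_mul]
  have hterm : (fun m : ℕ => evenExtension a m * z ^ m) ∘ (fun n : ℕ => 2 * n) =
      fun n : ℕ => ((d - 2)‼ : ℝ) / (((2 * n)‼ : ℝ) * ((d + 2 * n - 2)‼ : ℝ)) * z ^ (2 * n) := by
    funext n
    simp only [Function.comp_apply, evenExtension_two_mul, ha]
  have hL : Summable (fun m : ℕ => ‖evenExtension a m * z ^ m‖) := by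
    refine (hinj.summable_iff fun m hm => by rw [hzero m hm, norm_zero]).1 ?_
    convert hsum using 1
    funext n
    exact congrArg abs (congrFun hterm n)
  have hLsum : ∑' m : ℕ, evenExtension a m * z ^ m = ∑' n : ℕ,
      ((d - 2)‼ : ℝ) / (((2 * n)‼ : ℝ) * ((d + 2 * n - 2)‼ : ℝ)) * z ^ (2 * n) := by
    rw [← hterm]
    refine (hinj.tsum_eq fun m hm => ?_).symm
    by_contra h
    exact hm (hzero m h)
  have hE : Summable (fun m : ℕ => ‖z ^ m / (m ! : ℝ)‖) :=
    (Real.summable_pow_div_factorial z).norm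
  have hEsum : ∑' m : ℕ, z ^ m / (m ! : ℝ) = Real.exp z := by
    rw [Real.exp_eq_exp_ℝ, NormedSpace.exp_eq_tsum_div]
  have hcoeff : ∀ k : ℕ, ∑ p ∈ Finset.HasAntidiagonal.antidiagonal k,
      z ^ p.1 / (p.1 ! : ℝ) * (evenExtension a p.2 * z ^ p.2) =
      (∏ j ∈ Finset.range k, (((d : ℝ) - 1) / 2 + j) / ((d : ℝ) - 1 + j)) *
        (2 ^ k / (k ! : ℝ)) * z ^ k := by
    intro k
    rw [← coeff_exp_mul_evenExtension _ hc a ha0 harec k, PowerSeries.coeff_mul,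
      Finset.sum_mul]
    refine Finset.sum_congr rfl fun p hp => ?_
    rw [← Finset.HasAntidiagonal.mem_antidiagonal.1 hp, PowerSeries.coeff_exp, PowerSeries.coeff_mk, pow_add]
    simp only [one_div, map_inv₀, map_natCast]
    ring
  have hprod := summable_norm_sum_mul_antidiagonal_of_summable_norm hE hL
  have htsum := tsum_mul_tsum_eq_tsum_sum_antidiagonal_of_summable_norm hE hL
  simp only [hcoeff] at hprod htsum
  refine ⟨hsum, hprod, ?_⟩
  rw [← htsum, hEsum, hLsum, ← mul_assoc, ← Real.exp_add, neg_add_cancel, Real.exp_zero, one_mul]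
end

section
/- For all integers n ≥ 0 and d ≥ 2, with the rising factorial (x)_k = ∏_{j=0}^{k−1}(x+j): Σ_{k=0}^{n} (−1)^k · 2^k · ((d−1)/2)_k / ((n−k)! · k! · (d−1)_k) equals 0 when n is odd, and equals (d−2)!! / (n!! · (d+n−2)!!) when n is even. -/
open Real Nat

/-- The coefficient `(-2)^k (b)_k / (k! (2b)_k)` of the terminating hypergeometric sum. -/
noncomputable def hypergeometricCoeff (b : ℝ) (k : ℕ) : ℝ :=
  (-2) ^ k * (∏ j ∈ Finset.range k, (b + j)) / (k ! * ∏ j ∈ Finset.range k, (2 * b + j))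

/-- The normalized sum `₂F₁(-n, b; 2b; 2) / n!`. -/
noncomputable def hypergeometricSum (b : ℝ) (n : ℕ) : ℝ :=
  ∑ k ∈ Finset.range (n + 1), hypergeometricCoeff b k / (n - k)!

theorem hypergeometricCoeff_succ {b : ℝ} (hb : 0 < b) (k : ℕ) :
    hypergeometricCoeff b (k + 1) * ((k + 1) * (2 * b + k)) =
      hypergeometricCoeff b k * (-2 * (b + k)) := by
  have hprod : (∏ j ∈ Finset.range k, (2 * b + (j : ℝ))) ≠ 0 :=
    Finset.prod_ne_zero_iff.mpr fun j _ => by positivity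
  have hlast : 2 * b + (k : ℝ) ≠ 0 := by positivity
  have hfac : (k ! : ℝ) ≠ 0 := by positivity
  have hk : (k : ℝ) + 1 ≠ 0 := by positivity
  simp only [hypergeometricCoeff, Finset.prod_range_succ, Nat.factorial_succ, pow_succ]
  push_cast
  field_simp

/-- The telescoping identity behind the two-step recurrence, for partial sums. -/
theorem hypergeometricCoeff_telescope {b : ℝ} (hb : 0 < b) (K m : ℕ) :
    ((K + m : ℕ) + 1 : ℝ) * ((K + m : ℕ) + 2 * b) *
        (∑ k ∈ Finset.range K, hypergeometricCoeff b k / (K + m + 1 - k)!) -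
      ∑ k ∈ Finset.range K, hypergeometricCoeff b k / (K + m - 1 - k)! =
      -(hypergeometricCoeff b K * K * (2 * b + K - 1) / (m + 1)!) := by
  induction K generalizing m with
  | zero => simp
  | succ K ih =>
    have h := ih (m + 1)
    have hsucc := hypergeometricCoeff_succ hb K
    rw [show K + (m + 1) = K + 1 + m by omega] at h
    rw [Finset.sum_range_succ, Finset.sum_range_succ,
      show K + 1 + m + 1 - K = m + 2 by omega, show K + 1 + m - 1 - K = m by omega]
    rw [show m + 1 + 1 = m + 2 by omega] at h
    have h₂ : ((m + 2)! : ℝ) = (m + 2) * ((m + 1) * m !) := by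
      push_cast [Nat.factorial_succ]; ring
    have h₁ : ((m + 1)! : ℝ) = (m + 1) * m ! := by
      push_cast [Nat.factorial_succ]; ring
    have hfac : (m ! : ℝ) ≠ 0 := by positivity
    have hm₁ : (m : ℝ) + 1 ≠ 0 := by positivity
    have hm₂ : (m : ℝ) + 2 ≠ 0 := by positivity
    have hright : hypergeometricCoeff b (K + 1) * ((K + 1 : ℕ) : ℝ) *
        (2 * b + ((K + 1 : ℕ) : ℝ) - 1) = hypergeometricCoeff b K * (-2 * (b + K)) := by
      rw [← hsucc]; push_cast; ring
    rw [hright, mul_add, add_sub_add_comm, h, h₁, h₂]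
    push_cast
    field_simp
    ring

theorem hypergeometricSum_add_two {b : ℝ} (hb : 0 < b) (n : ℕ) :
    ((n : ℝ) + 2) * (n + 1 + 2 * b) * hypergeometricSum b (n + 2) = hypergeometricSum b n := by
  have h := hypergeometricCoeff_telescope hb (n + 1) 0
  have hsucc := hypergeometricCoeff_succ hb (n + 1)
  simp only [hypergeometricSum]
  rw [Finset.sum_range_succ, Finset.sum_range_succ, show n + 2 - (n + 1) = 1 by omega,
    show n + 2 - (n + 2) = 0 by omega]
  simp only [add_zero, zero_add, Nat.factorial_one, Nat.factorial_zero, Nat.cast_one, div_one,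
    show n + 1 - 1 = n by omega, show n + 1 + 1 = n + 2 by omega] at h hsucc ⊢
  push_cast at h hsucc
  linear_combination h + hsucc

theorem hypergeometricSum_eq (n d : ℕ) (hd : 2 ≤ d) :
    hypergeometricSum (((d : ℝ) - 1) / 2) n =
      if Odd n then 0 else ((d - 2)‼ : ℝ) / ((n‼ : ℝ) * ((d + n - 2)‼ : ℝ)) := by
  have hd' : (2 : ℝ) ≤ d := by exact_mod_cast hd
  have hb : 0 < ((d : ℝ) - 1) / 2 := by linarith
  induction n using Nat.twoStepInduction with
  | zero =>
    have h : ((d - 2)‼ : ℝ) ≠ 0 := by exact_mod_cast (Nat.doubleFactorial_pos _).ne'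
    simp [hypergeometricSum, hypergeometricCoeff, h]
  | one =>
    have h : (d : ℝ) - 1 ≠ 0 := by linarith
    simp [hypergeometricSum, hypergeometricCoeff, Finset.sum_range_succ]
    field_simp
    norm_num
  | more n ih _ =>
    have hrec := hypergeometricSum_add_two hb n
    rw [ih] at hrec
    have hn : (n : ℝ) + 2 ≠ 0 := by positivity
    have hdn : (d : ℝ) + n ≠ 0 := by positivity
    have hrec' : ((n : ℝ) + 2) * (d + n) * hypergeometricSum (((d : ℝ) - 1) / 2) (n + 2) =
        if Odd n then 0 else ((d - 2)‼ : ℝ) / ((n‼ : ℝ) * ((d + n - 2)‼ : ℝ)) := by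
      rw [← hrec]; ring
    have hparity : Odd (n + 2) ↔ Odd n := by simp [Nat.odd_add]
    simp only [hparity]
    split_ifs at hrec' ⊢
    · simpa [hn, hdn] using hrec'
    · have hdf : (d + (n + 2) - 2)‼ = (d + n) * (d + n - 2)‼ := by
        obtain ⟨m, hm⟩ : ∃ m, d + n = m + 2 := ⟨d + n - 2, by omega⟩
        rw [show d + (n + 2) - 2 = d + n by omega, hm, Nat.doubleFactorial_add_two,
          Nat.add_sub_cancel]
      rw [hdf, Nat.doubleFactorial_add_two, ← mul_right_inj' (mul_ne_zero hn hdn), hrec']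
      push_cast
      field_simp

theorem hypergeometric_sum_double_factorial (n d : ℕ) (hd : 2 ≤ d) :
    (∑ k ∈ Finset.range (n + 1),
        ((-1) ^ k * 2 ^ k * (∏ j ∈ Finset.range k, (((d : ℝ) - 1) / 2 + j)) /
          (((n - k)! : ℝ) * (k ! : ℝ) * ∏ j ∈ Finset.range k, ((d : ℝ) - 1 + j)))) =
      if Odd n then 0 else ((d - 2)‼ : ℝ) / ((n‼ : ℝ) * ((d + n - 2)‼ : ℝ)) := by
  rw [← hypergeometricSum_eq n d hd, hypergeometricSum]
  refine Finset.sum_congr rfl fun k _ => ?_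
  rw [hypergeometricCoeff, mul_div_cancel₀ _ (two_ne_zero' ℝ), ← mul_pow, div_div]
  congr 1
  · norm_num
  · ring
end

section
/- Let f : [0,1] → ℝ be a 1-Lipschitz function and let ε > 0. Then, with n = 2·⌈4·ε^{−3}⌉, there exists an even polynomial p(z) = p_0 + p_2 z² + p_4 z⁴ + ⋯ + p_n z^n of degree at most n such that sup_{z ∈ [0,1]} |p(z) − f(z)| ≤ ε, and such that each of the coefficients p_2, p_4, …, p_n is bounded in absolute value by 2^n. -/
open Real

open Polynomial in
theorem abs_coeff_one_sub_X_pow_le (r i : ℕ) : |((1 - X : ℝ[X]) ^ r).coeff i| ≤ 2 ^ r := by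
  induction r generalizing i with
  | zero =>
    rw [pow_zero, coeff_one]
    split_ifs <;> simp
  | succ r ih =>
    rw [pow_succ', sub_mul, one_mul, coeff_sub]
    have hX : |(X * (1 - X : ℝ[X]) ^ r).coeff i| ≤ 2 ^ r := by
      cases i with
      | zero => simp
      | succ i => rw [coeff_X_mul]; exact ih i
    calc _ ≤ _ := abs_sub _ _
      _ ≤ 2 ^ r + 2 ^ r := add_le_add (ih i) hX
      _ = 2 ^ (r + 1) := by ring

open Polynomial in
theorem abs_coeff_bernsteinPolynomial_le (m k j : ℕ) :
    |(bernsteinPolynomial ℝ m k).coeff j| ≤ m.choose k * 2 ^ (m - k) := by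
  rw [bernsteinPolynomial, mul_assoc, ← C_eq_natCast, coeff_C_mul, abs_mul, Nat.abs_cast,
    coeff_X_pow_mul']
  gcongr
  split_ifs
  · exact abs_coeff_one_sub_X_pow_le _ _
  · simp

open Polynomial in
theorem natDegree_bernsteinPolynomial_le (m k : ℕ) (hk : k ≤ m) :
    (bernsteinPolynomial ℝ m k).natDegree ≤ m := by
  unfold bernsteinPolynomial
  compute_degree
  omega

theorem bernsteinPolynomial_eval_nonneg (m k : ℕ) {y : ℝ} (h0 : 0 ≤ y) (h1 : y ≤ 1) :
    0 ≤ (bernsteinPolynomial ℝ m k).eval y := by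
  have : 0 ≤ 1 - y := sub_nonneg.2 h1
  simp only [bernsteinPolynomial, Polynomial.eval_mul, Polynomial.eval_pow, Polynomial.eval_X,
    Polynomial.eval_sub, Polynomial.eval_one, Polynomial.eval_natCast]
  positivity

theorem sum_eval_bernsteinPolynomial (m : ℕ) (y : ℝ) :
    ∑ k ∈ Finset.range (m + 1), (bernsteinPolynomial ℝ m k).eval y = 1 := by
  rw [← Polynomial.eval_finsetSum, bernsteinPolynomial.sum, Polynomial.eval_one]

theorem sum_sq_mul_eval_bernsteinPolynomial {m : ℕ} (hm : m ≠ 0) (y : ℝ) :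
    ∑ k ∈ Finset.range (m + 1), ((k : ℝ) / m - y) ^ 2 * (bernsteinPolynomial ℝ m k).eval y =
      y * (1 - y) / m := by
  have hm' : (m : ℝ) ≠ 0 := Nat.cast_ne_zero.2 hm
  have h := congrArg (Polynomial.eval y) (bernsteinPolynomial.variance ℝ m)
  simp only [Polynomial.eval_finsetSum, Polynomial.eval_mul, Polynomial.eval_pow,
    Polynomial.eval_sub, Polynomial.eval_X, Polynomial.eval_natCast,
    Polynomial.eval_one, nsmul_eq_mul] at h
  have h' : ∑ k ∈ Finset.range (m + 1), ((k : ℝ) / m - y) ^ 2 *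
      (bernsteinPolynomial ℝ m k).eval y = (m * y * (1 - y)) / m ^ 2 := by
    rw [← h, Finset.sum_div]
    refine Finset.sum_congr rfl fun k _ => ?_
    field_simp
    ring
  rw [h']
  field_simp

/-- The mean of `(√(k / m) - z) ^ 2` under the binomial distribution with parameter `z ^ 2`. -/
theorem sum_sqrt_sub_sq_mul_eval_bernsteinPolynomial_le {m : ℕ} (hm : m ≠ 0) {z : ℝ}
    (h0 : 0 ≤ z) (h1 : z ≤ 1) :
    ∑ k ∈ Finset.range (m + 1), (√((k : ℝ) / m) - z) ^ 2 *
      (bernsteinPolynomial ℝ m k).eval (z ^ 2) ≤ 1 / m := by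
  rcases h0.eq_or_lt with rfl | hz
  · refine le_trans (Finset.sum_nonpos fun k _ => ?_) (by positivity : (0 : ℝ) ≤ 1 / m)
    rw [zero_pow two_ne_zero, bernsteinPolynomial.eval_at_0]
    split_ifs with h <;> simp [h]
  · have hy1 : z ^ 2 ≤ 1 := pow_le_one₀ h0 h1
    have hz2 : 0 < z ^ 2 := by positivity
    refine le_of_mul_le_mul_left ?_ hz2
    calc _ ≤ ∑ k ∈ Finset.range (m + 1), ((k : ℝ) / m - z ^ 2) ^ 2 *
          (bernsteinPolynomial ℝ m k).eval (z ^ 2) := by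
          rw [Finset.mul_sum]
          refine Finset.sum_le_sum fun k _ => ?_
          rw [← mul_assoc]
          refine mul_le_mul_of_nonneg_right ?_
            (bernsteinPolynomial_eval_nonneg m k hz2.le hy1)
          have hs : 0 ≤ √((k : ℝ) / m) := Real.sqrt_nonneg _
          have hq : √((k : ℝ) / m) ^ 2 = k / m := Real.sq_sqrt (by positivity)
          generalize √((k : ℝ) / m) = s at hs hq ⊢
          rw [← hq, sq_sub_sq, mul_pow]
          gcongr
          linarith
      _ = z ^ 2 * (1 - z ^ 2) / m := sum_sq_mul_eval_bernsteinPolynomial hm _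
      _ ≤ z ^ 2 * (1 / m) := by
          rw [mul_div_assoc]
          gcongr
          linarith

theorem abs_bernstein_sqrt_sub_le {f : ℝ → ℝ} (hf : LipschitzOnWith 1 f (Set.Icc 0 1))
    {m : ℕ} (hm : m ≠ 0) {ε : ℝ} (hε : 0 < ε) (hmε : 1 / (m : ℝ) ≤ ε ^ 2) {z : ℝ}
    (hz : z ∈ Set.Icc (0 : ℝ) 1) :
    |∑ k ∈ Finset.range (m + 1), f √((k : ℝ) / m) *
      (bernsteinPolynomial ℝ m k).eval (z ^ 2) - f z| ≤ ε := by
  have hy1 : z ^ 2 ≤ 1 := pow_le_one₀ hz.1 hz.2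
  have hsum := sum_eval_bernsteinPolynomial m (z ^ 2)
  calc _ = |∑ k ∈ Finset.range (m + 1), (f √((k : ℝ) / m) - f z) *
        (bernsteinPolynomial ℝ m k).eval (z ^ 2)| := by
        simp only [sub_mul, Finset.sum_sub_distrib, ← Finset.mul_sum, hsum, mul_one]
    _ ≤ ∑ k ∈ Finset.range (m + 1), |(f √((k : ℝ) / m) - f z) *
        (bernsteinPolynomial ℝ m k).eval (z ^ 2)| := Finset.abs_sum_le_sum_abs _ _
    _ ≤ ∑ k ∈ Finset.range (m + 1), (((√((k : ℝ) / m) - z) ^ 2 *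
        (bernsteinPolynomial ℝ m k).eval (z ^ 2)) / (2 * ε) +
        ε / 2 * (bernsteinPolynomial ℝ m k).eval (z ^ 2)) := by
        refine Finset.sum_le_sum fun k hk => ?_
        have hw := bernsteinPolynomial_eval_nonneg m k (sq_nonneg z) hy1
        rw [abs_mul, abs_of_nonneg hw, mul_div_right_comm, ← add_mul]
        refine mul_le_mul_of_nonneg_right ?_ hw
        have hkm : (k : ℝ) ≤ m := by exact_mod_cast Finset.mem_range_succ_iff.1 hk
        have hs : √((k : ℝ) / m) ∈ Set.Icc (0 : ℝ) 1 :=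
          ⟨Real.sqrt_nonneg _, Real.sqrt_le_one.2 (div_le_one_of_le₀ hkm (by positivity))⟩
        have hL := hf.dist_le_mul _ hs _ hz
        rw [Real.dist_eq, Real.dist_eq, NNReal.coe_one, one_mul] at hL
        refine hL.trans ?_
        rw [← sq_abs (√((k : ℝ) / m) - z)]
        set t := |√((k : ℝ) / m) - z|
        have h : t ^ 2 / (2 * ε) + ε / 2 - t = (t - ε) ^ 2 / (2 * ε) := by
          field_simp
          ring
        have h' : 0 ≤ (t - ε) ^ 2 / (2 * ε) := by positivity
        linarith
    _ ≤ ε ^ 2 / (2 * ε) + ε / 2 * 1 := by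
        rw [Finset.sum_add_distrib, ← Finset.sum_div, ← Finset.mul_sum, hsum]
        gcongr
        exact (sum_sqrt_sub_sq_mul_eval_bernsteinPolynomial_le hm hz.1 hz.2).trans hmε
    _ = ε := by
        field_simp
        ring

open Polynomial in
theorem abs_coeff_sum_bernsteinPolynomial_le {m : ℕ} {g : ℕ → ℝ} (hg : ∀ k ≤ m, |g k| ≤ 1)
    (j : ℕ) :
    |(∑ k ∈ Finset.range (m + 1), C (g k) * bernsteinPolynomial ℝ m k).coeff j| ≤
      2 ^ (2 * m) := by
  rw [finsetSum_coeff]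
  calc _ ≤ ∑ k ∈ Finset.range (m + 1), |(C (g k) * bernsteinPolynomial ℝ m k).coeff j| :=
        Finset.abs_sum_le_sum_abs _ _
    _ ≤ ∑ k ∈ Finset.range (m + 1), 1 ^ k * 2 ^ (m - k) * (m.choose k : ℝ) := by
        refine Finset.sum_le_sum fun k hk => ?_
        rw [coeff_C_mul, abs_mul, one_pow, one_mul, mul_comm (2 ^ (m - k) : ℝ)]
        calc _ ≤ 1 * ((m.choose k : ℝ) * 2 ^ (m - k)) :=
              mul_le_mul (hg k (Finset.mem_range_succ_iff.1 hk))
                (abs_coeff_bernsteinPolynomial_le m k j) (abs_nonneg _) zero_le_one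
          _ = _ := one_mul _
    _ = (1 + 2) ^ m := (add_pow _ _ _).symm
    _ ≤ (2 ^ 2) ^ m := by gcongr; norm_num
    _ = 2 ^ (2 * m) := (pow_mul _ _ _).symm

theorem even_polynomial_approximation
    (f : ℝ → ℝ) (hf : LipschitzOnWith 1 f (Set.Icc 0 1)) (ε : ℝ) (hε : 0 < ε) :
    ∃ p : ℕ → ℝ,
      (∀ j, 1 ≤ j → j ≤ ⌈4 * ε⁻¹ ^ 3⌉₊ → |p j| ≤ 2 ^ (2 * ⌈4 * ε⁻¹ ^ 3⌉₊)) ∧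
      ∀ z ∈ Set.Icc (0 : ℝ) 1,
        |(∑ j ∈ Finset.range (⌈4 * ε⁻¹ ^ 3⌉₊ + 1), p j * z ^ (2 * j)) - f z| ≤ ε := by
  have hm4 : 4 * ε⁻¹ ^ 3 ≤ (⌈4 * ε⁻¹ ^ 3⌉₊ : ℝ) := Nat.le_ceil _
  have hm : ⌈4 * ε⁻¹ ^ 3⌉₊ ≠ 0 := (Nat.ceil_pos.2 (by positivity)).ne'
  generalize ⌈4 * ε⁻¹ ^ 3⌉₊ = m at hm4 hm ⊢
  have hf0 : ∀ z ∈ Set.Icc (0 : ℝ) 1, |f z - f 0| ≤ 1 := fun z hz => by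
    have hL := hf.dist_le_mul z hz 0 (by simp)
    rw [Real.dist_eq, Real.dist_eq, NNReal.coe_one, one_mul, sub_zero, abs_of_nonneg hz.1] at hL
    exact hL.trans hz.2
  rcases le_or_gt 1 ε with h1 | h1
  · refine ⟨fun j => if j = 0 then f 0 else 0, fun j hj _ => ?_, fun z hz => ?_⟩
    · simp [show j ≠ 0 by omega]
    · have : ∑ j ∈ Finset.range (m + 1), (if j = 0 then f 0 else 0) * z ^ (2 * j) = f 0 := by
        simp
      rw [this, abs_sub_comm]
      exact (hf0 z hz).trans h1
  · have hmε : 1 / (m : ℝ) ≤ ε ^ 2 := by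
      have hi : 1 ≤ ε⁻¹ := (one_le_inv₀ hε).2 h1.le
      have h2 : ε⁻¹ ^ 2 ≤ m := by
        refine le_trans ?_ hm4
        have := pow_le_pow_right₀ hi (show 2 ≤ 3 by norm_num)
        have : 0 ≤ ε⁻¹ ^ 3 := by positivity
        linarith
      rw [one_div]
      calc _ ≤ (ε⁻¹ ^ 2)⁻¹ := inv_anti₀ (by positivity) h2
        _ = ε ^ 2 := by simp
    let P : Polynomial ℝ := ∑ k ∈ Finset.range (m + 1),
      Polynomial.C (f √((k : ℝ) / m) - f 0) * bernsteinPolynomial ℝ m k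
    have hP : P.natDegree < m + 1 := Nat.lt_succ_of_le <|
      Polynomial.natDegree_sum_le_of_forall_le _ _ fun k hk =>
        (Polynomial.natDegree_C_mul_le _ _).trans
          (natDegree_bernsteinPolynomial_le m k (Finset.mem_range_succ_iff.1 hk))
    refine ⟨fun j => P.coeff j + if j = 0 then f 0 else 0, fun j hj _ => ?_, fun z hz => ?_⟩
    · simp only [show j ≠ 0 by omega, if_false, add_zero]
      refine abs_coeff_sum_bernsteinPolynomial_le (fun k hk => hf0 _ ?_) j
      have hkm : (k : ℝ) ≤ m := by exact_mod_cast hk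
      exact ⟨Real.sqrt_nonneg _, Real.sqrt_le_one.2 (div_le_one_of_le₀ hkm (by positivity))⟩
    · have h0 : ∑ j ∈ Finset.range (m + 1), (if j = 0 then f 0 else 0) * z ^ (2 * j) = f 0 := by
        simp
      have hPe : ∑ j ∈ Finset.range (m + 1), P.coeff j * z ^ (2 * j) = P.eval (z ^ 2) := by
        simp only [Polynomial.eval_eq_sum_range' hP, pow_mul]
      have hPs : P.eval (z ^ 2) = ∑ k ∈ Finset.range (m + 1), f √((k : ℝ) / m) *
          (bernsteinPolynomial ℝ m k).eval (z ^ 2) - f 0 := by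
        simp only [P, Polynomial.eval_finsetSum, Polynomial.eval_mul, Polynomial.eval_C, sub_mul,
          Finset.sum_sub_distrib, ← Finset.mul_sum, sum_eval_bernsteinPolynomial, mul_one]
      simp only [add_mul, Finset.sum_add_distrib]
      rw [h0, hPe, hPs, sub_add_cancel]
      exact abs_bernstein_sqrt_sub_le hf hm hε hmε hz
end

section
/- Let n ≥ 2 be an integer and let η be a real number with 0 < η ≤ 1/n. Let V(η) be the n×n matrix with entries V(η)_{ij} = η^{i·j} for i, j ∈ {1,…,n}. Then V(η) is invertible, and every entry of its inverse satisfies |(V(η)^{−1})_{ij}| ≤ e · η^{i²/2 − i·n − i/2 + n − j}. -/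
open Real Matrix

open Polynomial in
/-- Multiplying by linear factors with small roots keeps the coefficients geometrically bounded. -/
lemma abs_coeff_mul_prod_X_sub_C_le {ι : Type*} {η B : ℝ} (hη : 0 ≤ η) {p : ℝ[X]} {d : ℕ}
    (hp : ∀ k, |p.coeff k| * η ^ k ≤ B * η ^ d) (s : Finset ι) (y : ι → ℝ)
    (hy : ∀ m ∈ s, 0 ≤ y m) (k : ℕ) :
    |(p * ∏ m ∈ s, (X - C (η * y m))).coeff k| * η ^ k
      ≤ (B * ∏ m ∈ s, (1 + y m)) * η ^ (d + s.card) := by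
  classical
  induction s using Finset.induction_on generalizing k with
  | empty => simpa using hp k
  | insert a s ha ih =>
    have ih' := ih fun m hm => hy m (Finset.mem_insert_of_mem hm)
    have hya := hy a (Finset.mem_insert_self _ _)
    rw [Finset.prod_insert ha, Finset.prod_insert ha, Finset.card_insert_of_notMem ha]
    set q := p * ∏ m ∈ s, (X - C (η * y m)) with hq
    set M := B * ∏ m ∈ s, (1 + y m) with hM
    have hpq : p * ((X - C (η * y a)) * ∏ m ∈ s, (X - C (η * y m)))
        = q * (X - C (η * y a)) := by rw [hq]; ring
    have hMq : B * ((1 + y a) * ∏ m ∈ s, (1 + y m)) = M * (1 + y a) := by rw [hM]; ring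
    rw [hpq, hMq, ← add_assoc, pow_succ]
    have hηy : 0 ≤ η * y a := mul_nonneg hη hya
    cases k with
    | zero =>
      have h0 := ih' 0
      have : |(q * (X - C (η * y a))).coeff 0| = |q.coeff 0| * (η * y a) := by
        rw [mul_coeff_zero]; simp [abs_mul, abs_of_nonneg hη, abs_of_nonneg hya]
      rw [this]
      have h1 := mul_le_mul_of_nonneg_right h0 hηy
      have h2 : 0 ≤ M * η ^ (d + s.card) * η :=
        mul_nonneg (le_trans (by positivity) h0) hη
      nlinarith
    | succ k =>
      have h0 := ih' k
      have h1 := mul_le_mul_of_nonneg_right (ih' (k + 1)) hηy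
      have h2 := mul_le_mul_of_nonneg_right h0 hη
      have : |(q * (X - C (η * y a))).coeff (k + 1)|
          ≤ |q.coeff k| + |q.coeff (k + 1)| * (η * y a) := by
        rw [mul_sub, coeff_sub, coeff_mul_X, coeff_mul_C]
        refine (abs_sub _ _).trans_eq ?_
        rw [abs_mul, abs_of_nonneg hηy]
      have h3 := mul_le_mul_of_nonneg_right this (pow_nonneg hη (k + 1))
      rw [pow_succ] at h3 h1 ⊢
      nlinarith

open Polynomial in
lemma abs_coeff_X_sub_C_le {η x : ℝ} (hη : 0 ≤ η) (hx : 0 ≤ x) (hxη : x ≤ η) (k : ℕ) :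
    |(X - C x : ℝ[X]).coeff k| * η ^ k ≤ 1 * η ^ 1 := by
  match k with
  | 0 => simpa [abs_of_nonneg hx] using hxη
  | 1 => simp
  | k + 2 => simpa [coeff_X, coeff_C] using hη

lemma one_add_pow_mul_one_sub_le {η : ℝ} (hη : 0 ≤ η) (hη1 : η ≤ 1) {a b : ℕ} (ha : a ≠ 0)
    (hb : 2 ≤ b) (hba : b ≤ a + 1) : (1 + η ^ a) * (1 - η) ≤ 1 - η ^ b := by
  rcases Nat.lt_or_ge a b with h | h
  · obtain rfl : b = a + 1 := by omega
    have : η ^ a ≤ η := pow_le_of_le_one hη hη1 ha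
    rw [pow_succ]; nlinarith
  · have h1 : η ^ a ≤ η ^ 2 := pow_le_pow_of_le_one hη hη1 (hb.trans h)
    have h2 : η ^ b ≤ η ^ 2 := pow_le_pow_of_le_one hη hη1 hb
    nlinarith [mul_le_mul_of_nonneg_right h1 (sub_nonneg.2 hη1), mul_nonneg hη (sq_nonneg (1 - η)),
      mul_nonneg hη (sub_nonneg.2 hη1), mul_nonneg (sq_nonneg η) (sub_nonneg.2 hη1)]

lemma prod_one_add_pow_mul_le {η : ℝ} (hη : 0 ≤ η) (hη1 : η ≤ 1) {c : ℕ} (hc : c ≠ 0) (N : ℕ) :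
    (∏ k ∈ Finset.range N, (1 + η ^ (c + k))) * (1 - η) ^ N
      ≤ ∏ k ∈ Finset.range N, (1 - η ^ (k + 2)) := by
  have h1 : (1 - η) ^ N = ∏ _k ∈ Finset.range N, (1 - η) := by simp
  rw [h1, ← Finset.prod_mul_distrib]
  refine Finset.prod_le_prod (fun k _ => ?_) fun k _ => ?_
  · exact mul_nonneg (by positivity) (by linarith)
  · exact one_add_pow_mul_one_sub_le hη hη1 (by omega) (by omega) (by omega)

lemma prod_one_add_pow_mul_le' {η : ℝ} (hη : 0 ≤ η) (hη1 : η ≤ 1) {c : ℕ} (hc : 2 ≤ c) (N : ℕ) :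
    (∏ k ∈ Finset.range N, (1 + η ^ (c + k))) * (1 - η) ^ N
      ≤ (1 + η ^ 2) * ∏ k ∈ Finset.range N, (1 - η ^ (k + 1)) := by
  cases N with
  | zero => simpa using sq_nonneg η
  | succ N =>
    rw [Finset.prod_range_succ', Finset.prod_range_succ', pow_succ]
    have h := prod_one_add_pow_mul_le hη hη1 (c := c + 1) (by omega) N
    have h2 : η ^ c ≤ η ^ 2 := pow_le_pow_of_le_one hη hη1 hc
    have h3 : (1 + η ^ c) * (1 - η) ≤ (1 + η ^ 2) * (1 - η) :=
      mul_le_mul_of_nonneg_right (by linarith) (by linarith)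
    have h4 : 0 ≤ (1 + η ^ c) * (1 - η) := mul_nonneg (by positivity) (by linarith)
    have h5 : 0 ≤ ∏ k ∈ Finset.range N, (1 - η ^ (k + 2)) :=
      Finset.prod_nonneg fun k _ => sub_nonneg.2 (pow_le_one₀ hη hη1)
    have := mul_le_mul h h3 h4 h5
    simp only [add_zero, zero_add, pow_one, add_assoc, add_comm 1] at this ⊢
    norm_num at this ⊢
    linarith

lemma one_add_sq_le_exp_mul_one_sub_pow {η : ℝ} (hη : 0 ≤ η) {N : ℕ} (hN : 1 ≤ N)
    (h : ((N : ℝ) + 1) * η ≤ 1) : 1 + η ^ 2 ≤ exp 1 * (1 - η) ^ N := by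
  have hN' : (1 : ℝ) ≤ N := by exact_mod_cast hN
  have hη2 : η ≤ 1 / 2 := by nlinarith
  have h1 : 1 ≤ exp (η + η ^ 2) * (1 - η) := by
    have := quadratic_le_exp_of_nonneg (x := η + η ^ 2) (by positivity)
    refine le_trans ?_ (mul_le_mul_of_nonneg_right this (by linarith))
    have h3 : 0 ≤ (1 - η) * (1 + η) ^ 2 - 2 * η := by nlinarith [mul_nonneg hη hη]
    nlinarith [mul_nonneg (sq_nonneg η) h3]
  have h2 : 1 ≤ exp (N * (η + η ^ 2)) * (1 - η) ^ N := by
    rw [exp_nat_mul, ← mul_pow]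
    exact one_le_pow₀ h1
  have h3 : 1 + η ^ 2 ≤ exp (η ^ 2) := by linarith [add_one_le_exp (η ^ 2)]
  have h4 : exp (η ^ 2) * exp (N * (η + η ^ 2)) ≤ exp 1 := by
    rw [← exp_add]
    apply exp_le_exp.2
    nlinarith
  have h5 : (0 : ℝ) ≤ (1 - η) ^ N := pow_nonneg (by linarith) _
  calc 1 + η ^ 2 ≤ exp (η ^ 2) * 1 := by linarith
    _ ≤ exp (η ^ 2) * (exp (N * (η + η ^ 2)) * (1 - η) ^ N) := by gcongr
    _ = exp (η ^ 2) * exp (N * (η + η ^ 2)) * (1 - η) ^ N := by ring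
    _ ≤ exp 1 * (1 - η) ^ N := by gcongr

open Polynomial in
/-- The monic polynomial whose roots are `η, …, η ^ (i + N + 1)` except `η ^ (i + 1)`. -/
noncomputable def nodalErase (η : ℝ) (i N : ℕ) : ℝ[X] :=
  (∏ m ∈ Finset.range i, (X - C (η ^ (m + 1)))) *
    ∏ k ∈ Finset.range N, (X - C (η ^ (i + k + 2)))

open Polynomial in
lemma natDegree_nodalErase_lt (η : ℝ) (i N : ℕ) :
    (nodalErase η i N).natDegree < i + N + 1 := by
  have h1 : (∏ m ∈ Finset.range i, (X - C (η ^ (m + 1)))).natDegree ≤ i := by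
    rw [natDegree_prod_of_monic _ _ fun _ _ => monic_X_sub_C _]; simp only [natDegree_X_sub_C]; simp
  have h2 : (∏ k ∈ Finset.range N, (X - C (η ^ (i + k + 2)))).natDegree ≤ N := by
    rw [natDegree_prod_of_monic _ _ fun _ _ => monic_X_sub_C _]; simp only [natDegree_X_sub_C]; simp
  have := natDegree_mul_le (p := ∏ m ∈ Finset.range i, (X - C (η ^ (m + 1))))
    (q := ∏ k ∈ Finset.range N, (X - C (η ^ (i + k + 2))))
  unfold nodalErase
  omega

open Polynomial in
lemma eval_nodalErase_of_ne (η : ℝ) {i N k : ℕ} (hk : k < i + N + 1) (hki : k ≠ i) :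
    (nodalErase η i N).eval (η ^ (k + 1)) = 0 := by
  rw [nodalErase, eval_mul, eval_prod, eval_prod]
  rcases Nat.lt_or_ge k i with h | h
  · rw [Finset.prod_eq_zero (Finset.mem_range.2 h) (by simp), zero_mul]
  · rw [Finset.prod_eq_zero (i := k - i - 1) (s := Finset.range N)
      (Finset.mem_range.2 (by omega)), mul_zero]
    have : i + (k - i - 1) + 2 = k + 1 := by omega
    simp [this]

open Polynomial in
lemma abs_eval_nodalErase {η : ℝ} (hη : 0 ≤ η) (hη1 : η ≤ 1) (i N : ℕ) :
    |(nodalErase η i N).eval (η ^ (i + 1))|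
      = η ^ (∑ m ∈ Finset.range i, (m + 1) + (i + 1) * N) *
        ((∏ m ∈ Finset.range i, (1 - η ^ (m + 1))) *
          ∏ k ∈ Finset.range N, (1 - η ^ (k + 1))) := by
  rw [nodalErase, eval_mul, eval_prod, eval_prod, abs_mul, Finset.abs_prod, Finset.abs_prod]
  have h1 : ∏ m ∈ Finset.range i, |(X - C (η ^ (m + 1))).eval (η ^ (i + 1))|
      = η ^ (∑ m ∈ Finset.range i, (m + 1)) * ∏ m ∈ Finset.range i, (1 - η ^ (m + 1)) := by
    rw [← Finset.prod_range_reflect (fun m => 1 - η ^ (m + 1)), ← Finset.prod_pow_eq_pow_sum,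
      ← Finset.prod_mul_distrib]
    refine Finset.prod_congr rfl fun m hm => ?_
    have hm := Finset.mem_range.1 hm
    have e : η ^ (i + 1) = η ^ (m + 1) * η ^ (i - 1 - m + 1) := by
      rw [← pow_add]; congr 1; omega
    have : η ^ (i - 1 - m + 1) ≤ 1 := pow_le_one₀ hη hη1
    have h0 : 0 ≤ η ^ (m + 1) := by positivity
    rw [eval_sub, eval_X, eval_C, e, abs_sub_comm, abs_of_nonneg (by nlinarith)]
    ring
  have h2 : ∏ k ∈ Finset.range N, |(X - C (η ^ (i + k + 2))).eval (η ^ (i + 1))|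
      = η ^ ((i + 1) * N) * ∏ k ∈ Finset.range N, (1 - η ^ (k + 1)) := by
    have : η ^ ((i + 1) * N) = ∏ _k ∈ Finset.range N, η ^ (i + 1) := by simp [pow_mul]
    rw [this, ← Finset.prod_mul_distrib]
    refine Finset.prod_congr rfl fun k _ => ?_
    have e : η ^ (i + k + 2) = η ^ (i + 1) * η ^ (k + 1) := by
      rw [← pow_add]; congr 1; omega
    have : η ^ (k + 1) ≤ 1 := pow_le_one₀ hη hη1
    have h0 : 0 ≤ η ^ (i + 1) := by positivity
    rw [eval_sub, eval_X, eval_C, e, abs_of_nonneg (by nlinarith)]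
    ring
  rw [h1, h2, pow_add]
  ring

open Polynomial in
lemma abs_coeff_nodalErase_le {η : ℝ} (hη : 0 ≤ η) {i N : ℕ} (hiN : 1 ≤ i + N)
    (h : ((i : ℝ) + N + 1) * η ≤ 1) (j : ℕ) :
    |(nodalErase η i N).coeff j| * η ^ j
      ≤ exp 1 * ((∏ m ∈ Finset.range i, (1 - η ^ (m + 1))) *
          ∏ k ∈ Finset.range N, (1 - η ^ (k + 1))) * η ^ (i + N) := by
  have hη1 : η < 1 := by
    have : (1 : ℝ) ≤ i + N := by exact_mod_cast hiN
    nlinarith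
  set Q := (∏ m ∈ Finset.range i, (1 - η ^ (m + 1))) *
    ∏ k ∈ Finset.range N, (1 - η ^ (k + 1)) with hQ
  have hQ0 : 0 ≤ Q := mul_nonneg
    (Finset.prod_nonneg fun k _ => sub_nonneg.2 (pow_le_one₀ hη hη1.le))
    (Finset.prod_nonneg fun k _ => sub_nonneg.2 (pow_le_one₀ hη hη1.le))
  obtain ⟨B, hB, hBQ⟩ : ∃ B, |(nodalErase η i N).coeff j| * η ^ j ≤ B * η ^ (i + N) ∧
      B * (1 - η) ^ (i + N) ≤ (1 + η ^ 2) * Q := by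
    rcases i with _ | i
    · obtain ⟨N, rfl⟩ : ∃ M, N = M + 1 := ⟨N - 1, by omega⟩
      refine ⟨∏ k ∈ Finset.range N, (1 + η ^ (2 + k)), ?_, ?_⟩
      · have hb := abs_coeff_mul_prod_X_sub_C_le hη (abs_coeff_X_sub_C_le hη (x := η ^ 2)
          (by positivity) (pow_le_of_le_one hη hη1.le two_ne_zero)) (Finset.range N)
          (fun k => η ^ (2 + k)) (fun _ _ => by positivity) j
        have e : nodalErase η 0 (N + 1)
            = (X - C (η ^ 2)) * ∏ k ∈ Finset.range N, (X - C (η * η ^ (2 + k))) := by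
          rw [nodalErase, Finset.prod_range_succ']
          simp only [Finset.range_zero, Finset.prod_empty, one_mul]
          rw [mul_comm]
          congr 1
          refine Finset.prod_congr rfl fun k _ => ?_
          rw [← pow_succ']
          congr 3
          omega
        rw [e]
        convert hb using 2
        · rw [one_mul]
        · rw [Finset.card_range]; congr 1; omega
      · have hb := prod_one_add_pow_mul_le hη hη1.le two_ne_zero N
        have e : Q = (∏ k ∈ Finset.range N, (1 - η ^ (k + 2))) * (1 - η) := by
          rw [hQ, Finset.prod_range_succ']
          simp
        have h1 := mul_le_mul_of_nonneg_right hb (sub_nonneg.2 hη1.le)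
        rw [← e] at h1
        rw [zero_add, pow_succ]
        nlinarith [mul_nonneg (sq_nonneg η) hQ0]
    · refine ⟨(∏ m ∈ Finset.range i, (1 + η ^ (1 + m))) *
        ∏ k ∈ Finset.range N, (1 + η ^ (i + 2 + k)), ?_, ?_⟩
      · have hb := abs_coeff_mul_prod_X_sub_C_le hη (abs_coeff_mul_prod_X_sub_C_le hη
          (abs_coeff_X_sub_C_le hη hη le_rfl) (Finset.range i)
          (fun k => η ^ (1 + k)) (fun _ _ => by positivity)) (Finset.range N)
          (fun k => η ^ (i + 2 + k)) (fun _ _ => by positivity) j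
        have e : nodalErase η (i + 1) N
            = (X - C η) * (∏ k ∈ Finset.range i, (X - C (η * η ^ (1 + k)))) *
              ∏ k ∈ Finset.range N, (X - C (η * η ^ (i + 2 + k))) := by
          rw [nodalErase, Finset.prod_range_succ']
          congr 1
          · rw [mul_comm, zero_add, pow_one]
            congr 1
            refine Finset.prod_congr rfl fun k _ => ?_
            rw [← pow_succ']
            congr 3
            omega
          · refine Finset.prod_congr rfl fun k _ => ?_
            rw [← pow_succ']
            congr 3
            omega
        rw [e]
        convert hb using 2
        · rw [one_mul]
        · rw [Finset.card_range, Finset.card_range]; congr 1; omega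
      · have h1 := prod_one_add_pow_mul_le hη hη1.le one_ne_zero i
        have h2 := prod_one_add_pow_mul_le' hη hη1.le (c := i + 2) (by omega) N
        have h3 : ∏ m ∈ Finset.range (i + 1), (1 - η ^ (m + 1))
            = (∏ m ∈ Finset.range i, (1 - η ^ (m + 2))) * (1 - η) := by
          rw [Finset.prod_range_succ']
          simp
        have h4 : 0 ≤ ∏ m ∈ Finset.range i, (1 - η ^ (m + 2)) :=
          Finset.prod_nonneg fun k _ => sub_nonneg.2 (pow_le_one₀ hη hη1.le)
        have h5 : 0 ≤ (∏ k ∈ Finset.range N, (1 + η ^ (i + 2 + k))) * (1 - η) ^ N :=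
          mul_nonneg (Finset.prod_nonneg fun k _ => by positivity)
            (pow_nonneg (sub_nonneg.2 hη1.le) _)
        have h6 := mul_le_mul_of_nonneg_right (mul_le_mul h1 h2 h5 h4) (sub_nonneg.2 hη1.le)
        rw [hQ, h3]
        calc _ = _ := by rw [pow_add, pow_succ]; ring
          _ ≤ _ := h6
          _ = _ := by ring
  have hpos : 0 < (1 - η) ^ (i + N) := pow_pos (sub_pos.2 hη1) _
  have he := one_add_sq_le_exp_mul_one_sub_pow hη hiN (by push_cast; exact h)
  have hBe : B ≤ exp 1 * Q := by
    refine le_of_mul_le_mul_right ?_ hpos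
    nlinarith [mul_le_mul_of_nonneg_right he hQ0]
  exact hB.trans (mul_le_mul_of_nonneg_right hBe (by positivity))

lemma vandermonde_eta_left_inverse {n : ℕ} {η : ℝ} (hη : 0 < η) (hη1 : η < 1) :
    (Matrix.of fun i j : Fin n => (nodalErase η i (n - 1 - i)).coeff j /
        (η ^ ((i : ℕ) + 1) * (nodalErase η i (n - 1 - i)).eval (η ^ ((i : ℕ) + 1)))) *
      (Matrix.of fun i j : Fin n => η ^ (((i : ℕ) + 1) * ((j : ℕ) + 1))) = 1 := by
  ext i k
  have hi : (i : ℕ) + (n - 1 - i) + 1 = n := by omega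
  rw [Matrix.mul_apply]
  set p := nodalErase η i (n - 1 - i) with hp
  set D := η ^ ((i : ℕ) + 1) * p.eval (η ^ ((i : ℕ) + 1)) with hD
  have hD0 : D ≠ 0 := by
    refine mul_ne_zero (by positivity) (abs_pos.1 ?_)
    rw [abs_eval_nodalErase hη.le hη1.le]
    have hf : ∀ m : ℕ, 0 < 1 - η ^ (m + 1) := fun m =>
      sub_pos.2 (pow_lt_one₀ hη.le hη1 (Nat.succ_ne_zero m))
    exact mul_pos (by positivity) (mul_pos (Finset.prod_pos fun m _ => hf m)
      (Finset.prod_pos fun m _ => hf m))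
  have hsum : ∑ j : Fin n, p.coeff j / D * η ^ (((j : ℕ) + 1) * ((k : ℕ) + 1))
      = η ^ ((k : ℕ) + 1) * p.eval (η ^ ((k : ℕ) + 1)) / D := by
    rw [Polynomial.eval_eq_sum_range' (n := n) (hi ▸ natDegree_nodalErase_lt η i _),
      ← Fin.sum_univ_eq_sum_range (fun j => p.coeff j * (η ^ ((k : ℕ) + 1)) ^ j),
      Finset.mul_sum, Finset.sum_div]
    refine Finset.sum_congr rfl fun j _ => ?_
    rw [mul_comm ((j : ℕ) + 1), pow_mul, pow_succ]
    ring
  simp only [Matrix.of_apply]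
  rw [hsum]
  by_cases hik : k = i
  · subst hik
    rw [Matrix.one_apply_eq, div_self hD0]
  · rw [Matrix.one_apply_ne (Ne.symm hik), eval_nodalErase_of_ne η (by omega)
      (fun h => hik (Fin.ext h)), mul_zero, zero_div]

theorem vandermonde_eta_inverse_entry_bound
    (n : ℕ) (hn : 2 ≤ n) (η : ℝ) (hη : 0 < η) (hη' : η ≤ 1 / n) :
    IsUnit (Matrix.of fun i j : Fin n => η ^ (((i : ℕ) + 1) * ((j : ℕ) + 1))) ∧
    ∀ i j : Fin n,
      |(Matrix.of fun i j : Fin n => η ^ (((i : ℕ) + 1) * ((j : ℕ) + 1)))⁻¹ i j|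
        ≤ Real.exp 1 *
          η ^ (((i : ℝ) + 1) ^ 2 / 2 - ((i : ℝ) + 1) * n - ((i : ℝ) + 1) / 2 +
                n - ((j : ℝ) + 1)) := by
  have hn' : (2 : ℝ) ≤ n := by exact_mod_cast hn
  have hnη : (n : ℝ) * η ≤ 1 := by
    rwa [le_div_iff₀ (by linarith), mul_comm] at hη'
  have hη1 : η < 1 := by nlinarith
  have hinv := vandermonde_eta_left_inverse (n := n) hη hη1
  refine ⟨IsUnit.of_mul_eq_one_right _ hinv, fun i j => ?_⟩
  rw [Matrix.inv_eq_left_inv hinv, Matrix.of_apply]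
  obtain ⟨N, hN⟩ : ∃ N, n - 1 - (i : ℕ) = N := ⟨_, rfl⟩
  have hi : (i : ℕ) + N + 1 = n := by omega
  have hiR : (n : ℝ) = i + N + 1 := by exact_mod_cast hi.symm
  rw [hN, abs_div, abs_mul, abs_eval_nodalErase hη.le hη1.le, abs_of_pos (pow_pos hη _)]
  have hc := abs_coeff_nodalErase_le hη.le (i := i) (N := N) (by omega) (hiR ▸ hnη) j
  set Q := (∏ m ∈ Finset.range (i : ℕ), (1 - η ^ (m + 1))) *
    ∏ k ∈ Finset.range N, (1 - η ^ (k + 1)) with hQ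
  have hf : ∀ m : ℕ, 0 < 1 - η ^ (m + 1) := fun m =>
    sub_pos.2 (pow_lt_one₀ hη.le hη1 (Nat.succ_ne_zero m))
  have hQ0 : 0 < Q := mul_pos (Finset.prod_pos fun m _ => hf m) (Finset.prod_pos fun m _ => hf m)
  set S := ∑ m ∈ Finset.range (i : ℕ), (m + 1) with hS
  have hSR : (S : ℝ) = (i : ℝ) * (i + 1) / 2 := by
    rw [hS]
    induction (i : ℕ) with
    | zero => simp
    | succ m ih => rw [Finset.sum_range_succ]; push_cast at ih ⊢; rw [ih]; ring
  have hexp : η ^ (((i : ℝ) + 1) ^ 2 / 2 - ((i : ℝ) + 1) * n - ((i : ℝ) + 1) / 2 +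
      n - ((j : ℝ) + 1)) * (η ^ ((i : ℕ) + 1) * η ^ (S + ((i : ℕ) + 1) * N)) * η ^ (j : ℕ)
      = η ^ ((i : ℕ) + N) := by
    simp only [← Real.rpow_natCast η, ← Real.rpow_add hη]
    congr 1
    push_cast
    rw [hSR, hiR]
    ring
  rw [div_le_iff₀ (by positivity)]
  refine le_of_mul_le_mul_right (hc.trans_eq ?_) (pow_pos hη (j : ℕ))
  rw [← hexp]
  ring
end
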